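/- Let p be a prime, let k, r and v_1 ≤ … ≤ v_r be positive integers, and let G = ⊕_{i=1}^r ℤ/p^{v_i}ℤ. Let n be a positive integer and for 1 ≤ i ≤ n let A_i be a finite subset of ℤ containing 0 whose elements are pairwise incongruent modulo p; put A = Π_{i=1}^n A_i and a_M = max_i #A_i. Let x = (x_1,…,x_n) ∈ G^n and g ∈ G, and let EGZ_{A,k}(g) denote the number of (a_1,…,a_n) ∈ A such that a_1·x_1 + … + a_n·x_n = g in G and p^k divides #{1 ≤ i ≤ n : a_i ≠ 0}. Then EGZ_{A,k}(g) = 0 or EGZ_{A,k}(g) ≥ m(#A_1,…,#A_n; #A_1 + … + #A_n − Σ_{i=1}^r (p^{v_i}−1) − (a_M−1)(p^k−1)). -/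

import Mathlib

/-- The balls-in-bins quantity `m(a₁,…,a_n; N)`: the minimum of `y₁⋯y_n` over all
integer tuples with `1 ≤ y_i ≤ a_i` and `∑ y_i = N` when `n ≤ N ≤ ∑ a_i`; extended by
`1` for `N < n` and by `∏ a_i` for `N > ∑ a_i`. -/
noncomputable def mBB (n : ℕ) (a : Fin n → ℕ) (N : ℤ) : ℕ :=
  if N < (n : ℤ) then 1
  else if (∑ i, (a i : ℤ)) < N then ∏ i, a i
  else sInf {P : ℕ | ∃ y : Fin n → ℕ,
    (∀ i, 1 ≤ y i ∧ y i ≤ a i) ∧ (∑ i, (y i : ℤ)) = N ∧ P = ∏ i, y i}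

open Polynomial in
theorem exists_reduced_coeffs {F : Type*} [Field F] {n : ℕ} (T : Finset F)
    (q : MvPolynomial (Fin (n + 1)) F) :
    ∃ c : ℕ → MvPolynomial (Fin n) F,
      (∀ j, c j ≠ 0 → (c j).totalDegree + j ≤ q.totalDegree) ∧
      ∀ (s : Fin n → F), ∀ t ∈ T, MvPolynomial.eval (Fin.cons t s : Fin (n + 1) → F) q =
        ∑ j ∈ Finset.range T.card, MvPolynomial.eval s (c j) * t ^ j := by
  classical
  set f := MvPolynomial.finSuccEquiv F n q with hf
  set φ : F[X] := ∏ t ∈ T, (X - C t) with hφ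
  have hmonic : φ.Monic := monic_prod_of_monic _ _ fun t _ => monic_X_sub_C t
  have hdeg : φ.natDegree = T.card := by
    rw [hφ, natDegree_prod_of_monic _ _ fun t _ => monic_X_sub_C t]; simp
  have hroot : ∀ t ∈ T, φ.eval t = 0 := fun t ht => by
    rw [hφ, eval_prod]; exact Finset.prod_eq_zero ht (by simp)
  set r : ℕ → F[X] := fun m => (X ^ m : F[X]) %ₘ φ with hr
  have hrdeg : ∀ m, (r m).degree < T.card := fun m => by
    rw [← hdeg, ← degree_eq_natDegree hmonic.ne_zero]
    exact degree_modByMonic_lt _ hmonic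
  have hrm : ∀ m j, m < j → (r m).coeff j = 0 := fun m j hj => by
    refine coeff_eq_zero_of_degree_lt ?_
    refine lt_of_le_of_lt (degree_modByMonic_le_left (p := X ^ m) (q := φ)) ?_
    rw [degree_X_pow]; exact_mod_cast hj
  have hreval : ∀ m, ∀ t ∈ T, (r m).eval t = t ^ m := fun m t ht => by
    have h := congrArg (eval t) (modByMonic_add_div (X ^ m : F[X]) φ)
    simpa [hroot t ht] using h
  refine ⟨fun j => ∑ m ∈ f.support, f.coeff m * MvPolynomial.C ((r m).coeff j), ?_, ?_⟩
  · intro j hj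
    have hfm : ∀ m ∈ f.support, (f.coeff m).totalDegree + m ≤ q.totalDegree := fun m hm =>
      MvPolynomial.totalDegree_coeff_finSuccEquiv_add_le q m (mem_support_iff.mp hm)
    have hle : j ≤ q.totalDegree := by
      obtain ⟨m, hm, hne⟩ := Finset.exists_ne_zero_of_sum_ne_zero hj
      have : j ≤ m := by
        by_contra hlt
        exact hne (by rw [hrm m j (by omega)]; simp)
      have := hfm m hm
      omega
    have : (∑ m ∈ f.support, f.coeff m * MvPolynomial.C ((r m).coeff j)).totalDegree
        ≤ q.totalDegree - j := by
      refine MvPolynomial.totalDegree_finsetSum_le fun m hm => ?_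
      rcases lt_or_ge m j with h | h
      · rw [hrm m j h]; simp
      · have h1 := MvPolynomial.totalDegree_mul (f.coeff m) (MvPolynomial.C ((r m).coeff j))
        rw [MvPolynomial.totalDegree_C] at h1
        have := hfm m hm
        omega
    exact (Nat.le_sub_iff_add_le hle).1 this
  · intro s t ht
    rw [MvPolynomial.eval_eq_eval_mv_eval', ← hf, eval_map, eval₂_eq_sum, Polynomial.sum]
    simp only [map_sum, map_mul, MvPolynomial.eval_C, Finset.sum_mul]
    rw [Finset.sum_comm]
    refine Finset.sum_congr rfl fun m _ => ?_
    rw [← hreval m t ht, eval_eq_sum_range' (n := T.card)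
      (by
        by_cases h0 : r m = 0
        · rw [h0, natDegree_zero, Finset.card_pos]; exact ⟨t, ht⟩
        · exact (natDegree_lt_iff_degree_lt h0).2 (hrdeg m)), Finset.mul_sum]
    exact Finset.sum_congr rfl fun j _ => by ring

open Polynomial in
theorem card_sub_le_card_filter_sum_ne_zero {F : Type*} [Field F] [DecidableEq F] (T : Finset F)
    (b : ℕ → F) {d j : ℕ} (hj : j < d) (hb : b j ≠ 0) (hlt : ∀ i, j < i → i < d → b i = 0) :
    T.card - j ≤ (T.filter fun t => ∑ i ∈ Finset.range d, b i * t ^ i ≠ 0).card := by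
  set P : F[X] := ∑ i ∈ Finset.range d, C (b i) * X ^ i with hP
  have hcoeff : ∀ m, P.coeff m = if m < d then b m else 0 := fun m => by
    simp [hP, coeff_C_mul, coeff_X_pow]
  have hP0 : P ≠ 0 := fun h => hb (by have := hcoeff j; rw [h] at this; simpa [hj] using this.symm)
  have hdeg : P.natDegree ≤ j := natDegree_le_iff_coeff_eq_zero.2 fun m hm => by
    rw [hcoeff]; split_ifs with h
    · exact hlt m hm h
    · rfl
  have heval : ∀ t, P.eval t = ∑ i ∈ Finset.range d, b i * t ^ i := fun t => by
    simp [hP, eval_finsetSum]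
  have h1 : (T.filter fun t => ∑ i ∈ Finset.range d, b i * t ^ i = 0).card ≤ j := by
    refine le_trans (Finset.card_le_card (t := P.roots.toFinset) fun t ht => ?_)
      ((Multiset.toFinset_card_le _).trans ((card_roots' P).trans hdeg))
    rw [Finset.mem_filter] at ht
    rw [Multiset.mem_toFinset, mem_roots hP0, IsRoot, heval, ht.2]
  have h2 := Finset.card_filter_add_card_filter_not (s := T)
    (fun t => ∑ i ∈ Finset.range d, b i * t ^ i = 0)
  simp only [ne_eq]
  omega

/-- The **Alon–Füredi theorem**: a polynomial which does not vanish identically on a finite grid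
has at least `∏ yᵢ` nonzeros there, for some `1 ≤ yᵢ ≤ #Sᵢ` whose sum is at least
`∑ #Sᵢ` minus the total degree. -/
theorem alon_furedi {F : Type*} [Field F] [DecidableEq F] (n : ℕ) (S : Fin n → Finset F)
    (q : MvPolynomial (Fin n) F) (h : ∃ a ∈ Fintype.piFinset S, MvPolynomial.eval a q ≠ 0) :
    ∃ y : Fin n → ℕ, (∀ i, 1 ≤ y i ∧ y i ≤ (S i).card) ∧
      ∑ i, (S i).card ≤ ∑ i, y i + q.totalDegree ∧
      ∏ i, y i ≤ ((Fintype.piFinset S).filter fun a => MvPolynomial.eval a q ≠ 0).card := by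
  induction n with
  | zero =>
    obtain ⟨a, ha, hne⟩ := h
    refine ⟨fun _ => 1, fun i => i.elim0, by simp, ?_⟩
    rw [Finset.prod_const_one]
    exact Finset.card_pos.2 ⟨a, Finset.mem_filter.2 ⟨ha, hne⟩⟩
  | succ n ih =>
    obtain ⟨c, hcdeg, hceval⟩ := exists_reduced_coeffs (S 0) q
    set S' : Fin n → Finset F := fun i => S i.succ with hS'
    set J := (Finset.range (S 0).card).filter fun j =>
      ∃ s ∈ Fintype.piFinset S', MvPolynomial.eval s (c j) ≠ 0 with hJ
    have hJne : J.Nonempty := by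
      obtain ⟨a, ha, hne⟩ := h
      rw [Fintype.mem_piFinset] at ha
      rw [← Fin.cons_self_tail a, hceval _ _ (ha 0)] at hne
      obtain ⟨j, hj, hj0⟩ := Finset.exists_ne_zero_of_sum_ne_zero hne
      exact ⟨j, Finset.mem_filter.2 ⟨hj, Fin.tail a, Fintype.mem_piFinset.2 fun i => ha i.succ,
        left_ne_zero_of_mul hj0⟩⟩
    set j := J.max' hJne with hj
    obtain ⟨hjlt, hjex⟩ := Finset.mem_filter.1 (J.max'_mem hJne)
    rw [Finset.mem_range] at hjlt
    have hmax : ∀ s ∈ Fintype.piFinset S', ∀ i, j < i → i < (S 0).card →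
        MvPolynomial.eval s (c i) = 0 := fun s hs i hji hi => by
      by_contra hne
      exact absurd (J.le_max' i (Finset.mem_filter.2 ⟨Finset.mem_range.2 hi, s, hs, hne⟩))
        (by omega)
    obtain ⟨y, hy, hysum, hyprod⟩ := ih S' (c j) hjex
    have hcj : (c j).totalDegree + j ≤ q.totalDegree := hcdeg j fun h0 => by
      obtain ⟨s, -, hs⟩ := hjex
      exact hs (by rw [← hj, h0, map_zero])
    refine ⟨Fin.cons ((S 0).card - j) y, fun i => ?_, ?_, ?_⟩
    · refine Fin.cases ?_ (fun i => ?_) i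
      · simp only [Fin.cons_zero]; omega
      · simpa using hy i
    · rw [Fin.sum_univ_succ, Fin.sum_univ_succ]
      simp only [Fin.cons_zero, Fin.cons_succ]
      simp only [hS'] at hysum
      omega
    · rw [Fin.prod_univ_succ]
      simp only [Fin.cons_zero, Fin.cons_succ]
      set U := (Fintype.piFinset S').filter fun s => MvPolynomial.eval s (c j) ≠ 0 with hU
      set V : (Fin n → F) → Finset F := fun s => (S 0).filter fun t =>
        ∑ i ∈ Finset.range (S 0).card, MvPolynomial.eval s (c i) * t ^ i ≠ 0 with hV
      have hVcard : ∀ s ∈ U, (S 0).card - j ≤ (V s).card := fun s hs => by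
        obtain ⟨hs1, hs2⟩ := Finset.mem_filter.1 hs
        exact card_sub_le_card_filter_sum_ne_zero (S 0) (fun i => MvPolynomial.eval s (c i)) hjlt
          hs2 (hmax s hs1)
      calc ((S 0).card - j) * ∏ i, y i ≤ ((S 0).card - j) * U.card := by gcongr
        _ = U.card • ((S 0).card - j) := by rw [smul_eq_mul, mul_comm]
        _ ≤ ∑ s ∈ U, (V s).card := Finset.card_nsmul_le_sum _ _ _ hVcard
        _ = (U.sigma V).card := (Finset.card_sigma _ _).symm
        _ ≤ _ := by
          refine Finset.card_le_card_of_injOn (fun z => (Fin.cons z.2 z.1 : Fin (n + 1) → F))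
            (fun z hz => ?_) (fun z _ w _ hzw => ?_)
          · obtain ⟨h1, h2⟩ := Finset.mem_sigma.1 hz
            obtain ⟨h1, -⟩ := Finset.mem_filter.1 h1
            obtain ⟨h2, h3⟩ := Finset.mem_filter.1 h2
            refine Finset.mem_filter.2 ⟨Fintype.mem_piFinset.2 fun i => ?_, ?_⟩
            · refine Fin.cases ?_ (fun i => ?_) i
              · simpa using h2
              · simpa using Fintype.mem_piFinset.1 h1 i
            · rwa [hceval _ _ h2]
          · obtain ⟨h1, h2⟩ := Fin.cons_inj.1 hzw
            exact Sigma.ext h2 (heq_of_eq h1)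

theorem exists_le_sum_eq {ι : Type*} [Fintype ι] (y : ι → ℕ) (hy : ∀ i, 1 ≤ y i) (N : ℕ)
    (hN : Fintype.card ι ≤ N) (hNy : N ≤ ∑ i, y i) :
    ∃ z : ι → ℕ, (∀ i, 1 ≤ z i ∧ z i ≤ y i) ∧ ∑ i, z i = N := by
  classical
  induction hNy using Nat.decreasingInduction with
  | self => exact ⟨y, fun i => ⟨hy i, le_rfl⟩, rfl⟩
  | of_succ N _ ih =>
    obtain ⟨z, hz, hsum⟩ := ih (by omega)
    obtain ⟨i, -, hi⟩ : ∃ i ∈ Finset.univ, 1 < z i := by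
      refine Finset.exists_lt_of_sum_lt (f := fun _ => 1) ?_
      rw [hsum]; simp; omega
    refine ⟨Function.update z i (z i - 1), fun l => ?_, ?_⟩
    · rcases eq_or_ne l i with rfl | hl
      · have := hz l
        rw [Function.update_self]; omega
      · rw [Function.update_of_ne hl]; exact hz l
    · rw [Finset.sum_update_of_mem (Finset.mem_univ i)]
      have := Finset.add_sum_erase Finset.univ z (Finset.mem_univ i)
      rw [Finset.erase_eq] at this
      omega

theorem not_dvd_choose_prime_pow_sub_one_iff {p : ℕ} (hp : p.Prime) (v N : ℕ) :
    ¬ p ∣ N.choose (p ^ v - 1) ↔ p ^ v ∣ N + 1 := by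
  have := Fact.mk hp
  have hp0 := hp.pos
  induction v generalizing N with
  | zero => simpa using hp.ne_one
  | succ v ih =>
    have hpv : 0 < p ^ v := pow_pos hp0 v
    have hsplit : p ^ (v + 1) - 1 = (p - 1) + p * (p ^ v - 1) := by
      rw [pow_succ', Nat.mul_sub, mul_one]
      have := Nat.le_mul_of_pos_right p hpv
      omega
    have hmod : (p ^ (v + 1) - 1) % p = p - 1 := by
      rw [hsplit, Nat.add_mul_mod_self_left, Nat.mod_eq_of_lt (by omega)]
    have hdiv : (p ^ (v + 1) - 1) / p = p ^ v - 1 := by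
      rw [hsplit, Nat.add_mul_div_left _ _ hp0, Nat.div_eq_of_lt (by omega), zero_add]
    have ihN := ih (N / p)
    have hL := Choose.choose_modEq_choose_mod_mul_choose_div_nat (p := p) (n := N)
      (k := p ^ (v + 1) - 1)
    rw [hmod, hdiv] at hL
    rw [hL.dvd_iff dvd_rfl, hp.dvd_mul, not_or]
    have hlt := Nat.mod_lt N hp0
    have hN := Nat.div_add_mod N p
    by_cases hr : N % p = p - 1
    · have hN1 : N + 1 = p * (N / p + 1) := by rw [mul_add]; omega
      rw [hr, Nat.choose_self, hN1, pow_succ', Nat.mul_dvd_mul_iff_left hp0]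
      simpa [hp.ne_one] using ihN
    · rw [Nat.choose_eq_zero_of_lt (by omega)]
      simp only [dvd_zero, not_true_eq_false, false_and, false_iff]
      intro hdvd
      have h1 : p ∣ N + 1 := (dvd_pow_self p (Nat.succ_ne_zero v)).trans hdvd
      have h2 : p ∣ N % p + 1 := by
        rw [← hN, add_assoc] at h1
        exact (Nat.dvd_add_right (dvd_mul_right _ _)).1 h1
      have := Nat.le_of_dvd (by omega) h2
      omega

/-- On the grid `∏ Aᵢ`, the function `f` is given by a polynomial of total degree at most `d`. -/
def IsPolyOn {ι R : Type*} [CommRing R] (A : ι → Finset ℤ) (d : ℕ) (f : (ι → ℤ) → R) : Prop :=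
  ∃ q : MvPolynomial ι R, q.totalDegree ≤ d ∧
    ∀ a, (∀ i, a i ∈ A i) → f a = MvPolynomial.eval (fun i => (a i : R)) q

namespace IsPolyOn

variable {ι R : Type*} [CommRing R] {A : ι → Finset ℤ} {d e : ℕ} {f g : (ι → ℤ) → R}

theorem mono (hf : IsPolyOn A d f) (h : d ≤ e) : IsPolyOn A e f :=
  let ⟨q, hq, hqf⟩ := hf
  ⟨q, hq.trans h, hqf⟩

theorem const (c : R) : IsPolyOn A d fun _ => c :=
  ⟨MvPolynomial.C c, by simp, by simp⟩

theorem mul (hf : IsPolyOn A d f) (hg : IsPolyOn A e g) :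
    IsPolyOn A (d + e) fun a => f a * g a := by
  obtain ⟨q, hq, hqf⟩ := hf
  obtain ⟨u, hu, hug⟩ := hg
  exact ⟨q * u, (MvPolynomial.totalDegree_mul _ _).trans (by gcongr),
    fun a ha => by simp only [hqf a ha, hug a ha, map_mul]⟩

theorem sum {κ : Type*} (s : Finset κ) {f : κ → (ι → ℤ) → R}
    (hf : ∀ j ∈ s, IsPolyOn A d (f j)) : IsPolyOn A d fun a => ∑ j ∈ s, f j a := by
  classical
  induction s using Finset.induction_on with
  | empty => simpa using const (A := A) (d := d) (0 : R)
  | insert j s hj ih =>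
    obtain ⟨q, hq, hqf⟩ := hf j (Finset.mem_insert_self j s)
    obtain ⟨u, hu, hug⟩ := ih fun l hl => hf l (Finset.mem_insert_of_mem hl)
    refine ⟨q + u, (MvPolynomial.totalDegree_add _ _).trans (max_le hq hu), fun a ha => ?_⟩
    simp only [Finset.sum_insert hj, hqf a ha, map_add, ← hug a ha]

theorem prod {κ : Type*} (s : Finset κ) {d : κ → ℕ} {f : κ → (ι → ℤ) → R}
    (hf : ∀ j ∈ s, IsPolyOn A (d j) (f j)) :
    IsPolyOn A (∑ j ∈ s, d j) fun a => ∏ j ∈ s, f j a := by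
  classical
  induction s using Finset.induction_on with
  | empty => simpa using const (A := A) (d := 0) (1 : R)
  | insert j s hj ih =>
    simp only [Finset.prod_insert hj, Finset.sum_insert hj]
    exact (hf j (Finset.mem_insert_self j s)).mul
      (ih fun l hl => hf l (Finset.mem_insert_of_mem hl))

theorem of_polynomial (i : ι) (P : Polynomial R) (hP : P.natDegree ≤ d) {h : ℤ → R}
    (hh : ∀ t ∈ A i, h t = P.eval (t : R)) : IsPolyOn A d fun a => h (a i) := by
  cases subsingleton_or_nontrivial R
  · exact ⟨0, by simp, fun _ _ => Subsingleton.elim _ _⟩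
  refine ⟨∑ m ∈ Finset.range (d + 1), MvPolynomial.C (P.coeff m) * MvPolynomial.X i ^ m,
    MvPolynomial.totalDegree_finsetSum_le fun m hm => ?_, fun a ha => ?_⟩
  · refine (MvPolynomial.totalDegree_mul _ _).trans ?_
    rw [MvPolynomial.totalDegree_C, MvPolynomial.totalDegree_X_pow, zero_add]
    exact Nat.lt_succ_iff.1 (Finset.mem_range.1 hm)
  · beta_reduce
    rw [hh _ (ha i), Polynomial.eval_eq_sum_range' (Nat.lt_succ_iff.2 hP)]
    simp

theorem of_card_le {F : Type*} [Field F] (i : ι)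
    (hinj : Set.InjOn (fun t : ℤ => (t : F)) (A i)) (hd : (A i).card ≤ d + 1) (h : ℤ → F) :
    IsPolyOn A d fun a => h (a i) := by
  classical
  refine of_polynomial i (Lagrange.interpolate (A i) (fun t : ℤ => (t : F)) h) ?_
    fun t ht => (Lagrange.eval_interpolate_at_node h hinj ht).symm
  refine Polynomial.natDegree_le_iff_coeff_eq_zero.2 fun m hm =>
    Polynomial.coeff_eq_zero_of_degree_lt ((Lagrange.degree_interpolate_lt h hinj).trans_le ?_)
  exact_mod_cast hd.trans hm

theorem choose_sum {w : ℕ} (s : Finset ι) (z : ι → ℤ → ℕ) (c : ℕ)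
    (hz : ∀ i e, IsPolyOn A (w * e) fun a => ((z i (a i)).choose e : R)) (d : ℕ) :
    IsPolyOn A (w * d) fun a => ((∑ i ∈ s, z i (a i) + c).choose d : R) := by
  classical
  induction s using Finset.induction_on generalizing d with
  | empty => simpa using const (A := A) (d := w * d) ((c.choose d : ℕ) : R)
  | insert i s hi ih =>
    simp only [Finset.sum_insert hi, add_assoc, Nat.add_choose_eq (z i _), Nat.cast_sum,
      Nat.cast_mul]
    refine sum _ fun m hm => ((hz i m.1).mul (ih m.2)).mono ?_
    rw [← mul_add, Finset.HasAntidiagonal.mem_antidiagonal.1 hm]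

theorem choose_of_card_le {p : ℕ} [Fact p.Prime] (i : ι)
    (hinj : Set.InjOn (fun t : ℤ => (t : ZMod p)) (A i)) (z : ℤ → ℕ) (c : ZMod p)
    (hz : ∀ t, (z t : ZMod p) = t * c) (e : ℕ) :
    IsPolyOn A e fun a => ((z (a i)).choose e : ZMod p) := by
  rcases lt_or_ge e p with he | he
  · have hfac : (e.factorial : ZMod p) ≠ 0 := by
      rw [Ne, ZMod.natCast_eq_zero_iff, (Fact.out : p.Prime).dvd_factorial]
      omega
    refine of_polynomial i (h := fun t => ((z t).choose e : ZMod p))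
      (Polynomial.C (e.factorial : ZMod p)⁻¹ *
        (descPochhammer (ZMod p) e).comp (Polynomial.C c * Polynomial.X)) ?_ fun t _ => ?_
    · refine (Polynomial.natDegree_C_mul_le _ _).trans (Polynomial.natDegree_comp_le.trans ?_)
      rw [descPochhammer_natDegree]
      exact (Nat.mul_le_mul_left e ((Polynomial.natDegree_C_mul_le _ _).trans
        Polynomial.natDegree_X_le)).trans (mul_one e).le
    · have : Polynomial.eval (t : ZMod p) (Polynomial.C c * Polynomial.X) = (z t : ZMod p) := by
        rw [hz, Polynomial.eval_mul, Polynomial.eval_C, Polynomial.eval_X, mul_comm]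
      rw [Polynomial.eval_mul, Polynomial.eval_C, Polynomial.eval_comp, this,
        descPochhammer_eval_eq_descFactorial, Nat.descFactorial_eq_factorial_mul_choose,
        Nat.cast_mul, inv_mul_cancel_left₀ hfac]
  · refine of_card_le i hinj ?_ fun t => ((z t).choose e : ZMod p)
    have := Finset.card_le_card_of_injOn (t := (Finset.univ : Finset (ZMod p)))
      (fun t : ℤ => (t : ZMod p)) (fun _ _ => Finset.mem_coe.2 (Finset.mem_univ _)) hinj
    rw [Finset.card_univ, ZMod.card] at this
    omega

end IsPolyOn

theorem mBB_le_prod {n : ℕ} {a y : Fin n → ℕ} {N : ℤ} (hy : ∀ i, 1 ≤ y i ∧ y i ≤ a i)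
    (hN : N ≤ ∑ i, (y i : ℤ)) : mBB n a N ≤ ∏ i, y i := by
  unfold mBB
  split_ifs with h1 h2
  · exact Nat.succ_le_of_lt (Finset.prod_pos fun i _ => (hy i).1)
  · have : ∑ i, (y i : ℤ) ≤ ∑ i, (a i : ℤ) :=
      Finset.sum_le_sum fun i _ => by exact_mod_cast (hy i).2
    omega
  · obtain ⟨M, rfl⟩ := Int.eq_ofNat_of_zero_le (show 0 ≤ N by omega)
    obtain ⟨z, hz, hsum⟩ := exists_le_sum_eq y (fun i => (hy i).1) M
      (by rw [Fintype.card_fin]; omega) (by exact_mod_cast hN)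
    have hmem : ∏ i, z i ∈ {P : ℕ | ∃ y : Fin n → ℕ,
        (∀ i, 1 ≤ y i ∧ y i ≤ a i) ∧ (∑ i, (y i : ℤ)) = M ∧ P = ∏ i, y i} :=
      ⟨z, fun i => ⟨(hz i).1, (hz i).2.trans (hy i).2⟩, by exact_mod_cast hsum, rfl⟩
    refine (Nat.sInf_le hmem).trans ?_
    exact Finset.prod_le_prod' fun i _ => (hz i).2

theorem mBB_le_card_filter_ne_zero {F : Type*} [Field F] [DecidableEq F] {n : ℕ}
    (A : Fin n → Finset ℤ)
    (hinj : ∀ i, Set.InjOn (fun t : ℤ => (t : F)) (A i)) {d : ℕ} {f : (Fin n → ℤ) → F}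
    (hf : IsPolyOn A d f) (hne : ∃ a ∈ Fintype.piFinset A, f a ≠ 0) :
    mBB n (fun i => (A i).card) ((∑ i, ((A i).card : ℤ)) - d) ≤
      ((Fintype.piFinset A).filter fun a => f a ≠ 0).card := by
  obtain ⟨q, hq, hqf⟩ := hf
  set S : Fin n → Finset F := fun i => (A i).image fun t : ℤ => (t : F) with hS
  have hcard : ∀ i, (S i).card = (A i).card := fun i => Finset.card_image_of_injOn (hinj i)
  obtain ⟨a, ha, hfa⟩ := hne
  have ha' := Fintype.mem_piFinset.1 ha
  obtain ⟨y, hy, hsum, hprod⟩ := alon_furedi n S q ⟨fun i => (a i : F),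
    Fintype.mem_piFinset.2 fun i => Finset.mem_image_of_mem _ (ha' i), by rwa [← hqf a ha']⟩
  simp only [hcard] at hy hsum
  refine (mBB_le_prod hy ?_).trans (hprod.trans ?_)
  · zify at hsum hq
    linarith
  · refine Finset.card_le_card_of_surjOn (fun b i => (b i : F)) fun b hb => ?_
    obtain ⟨hb1, hb2⟩ := Finset.mem_filter.1 hb
    have : ∀ i, ∃ t ∈ A i, (t : F) = b i := fun i =>
      Finset.mem_image.1 (Fintype.mem_piFinset.1 hb1 i)
    choose t ht htb using this
    refine ⟨t, Finset.mem_coe.2 (Finset.mem_filter.2 ⟨Fintype.mem_piFinset.2 ht, ?_⟩), funext htb⟩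
    rw [hqf t ht]
    simpa only [htb] using hb2

/-- **EGZ-type theorem**: in `G = ⊕_i ℤ/p^{v_i}ℤ` with `v₁ ≤ … ≤ v_r`, for weight sets
`0 ∈ A_i ⊆ ℤ` pairwise incongruent mod `p` with `a_M = max_i #A_i`, the number
`EGZ_{A,k}(g)` of `a ∈ ∏ A_i` with `∑ a_i·x_i = g` and `p^k ∣ #{i : a_i ≠ 0}` is `0` or
at least `m(#A₁,…,#A_n; #A₁+⋯+#A_n - ∑_i (p^{v_i}-1) - (a_M-1)(p^k-1))`. -/
theorem egz_type_theorem
    (p : ℕ) (hp : p.Prime) (k r : ℕ) (hk : 0 < k) (hr : 0 < r)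
    (v : Fin r → ℕ) (hv : ∀ j, 0 < v j) (hvmono : Monotone v)
    (n : ℕ) (hn : 0 < n)
    (A : Fin n → Finset ℤ) (h0A : ∀ i, (0 : ℤ) ∈ A i)
    (hAp : ∀ i, ∀ a ∈ A i, ∀ b ∈ A i, (p : ℤ) ∣ (a - b) → a = b)
    (x : Fin n → (∀ j : Fin r, ZMod (p ^ v j)))
    (g : ∀ j : Fin r, ZMod (p ^ v j)) :
    Set.ncard {a : Fin n → ℤ | (∀ i, a i ∈ A i) ∧ (∑ i, a i • x i = g) ∧
        p ^ k ∣ (Finset.univ.filter fun i => a i ≠ 0).card} = 0 ∨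
      mBB n (fun i => (A i).card)
        ((∑ i, ((A i).card : ℤ)) - (∑ j, ((p : ℤ) ^ v j - 1)) -
          (((Finset.univ.sup fun i => (A i).card : ℕ) : ℤ) - 1) * ((p : ℤ) ^ k - 1)) ≤
        Set.ncard {a : Fin n → ℤ | (∀ i, a i ∈ A i) ∧ (∑ i, a i • x i = g) ∧
          p ^ k ∣ (Finset.univ.filter fun i => a i ≠ 0).card} := by
  classical
  have := Fact.mk hp
  have hpos : ∀ m, 1 ≤ p ^ m := fun m => Nat.one_le_pow _ _ hp.pos
  have (j : Fin r) : NeZero (p ^ v j) := ⟨(pow_pos hp.pos (v j)).ne'⟩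
  have hinj : ∀ i, Set.InjOn (fun t : ℤ => (t : ZMod p)) (A i) := fun i a ha b hb hab =>
    hAp i a ha b hb ((ZMod.intCast_eq_intCast_iff_dvd_sub b a p).1 hab.symm)
  set M : ℕ := Finset.univ.sup fun i => (A i).card with hM
  have hMle : ∀ i, (A i).card ≤ M := fun i =>
    Finset.le_sup (f := fun i => (A i).card) (Finset.mem_univ i)
  have hM1 : 1 ≤ M := (Finset.card_pos.2 ⟨0, h0A ⟨0, hn⟩⟩).trans_le (hMle ⟨0, hn⟩)
  set Z : Fin r → (Fin n → ℤ) → ℕ := fun j a =>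
    ∑ i, ((a i : ZMod (p ^ v j)) * x i j).val + (-g j - 1).val with hZ
  set W : (Fin n → ℤ) → ℕ := fun a => ∑ i, (if a i ≠ 0 then 1 else 0) + (p ^ k - 1) with hW
  set f : (Fin n → ℤ) → ZMod p := fun a =>
    (∏ j, ((Z j a).choose (p ^ v j - 1) : ZMod p)) * ((W a).choose (p ^ k - 1) : ZMod p) with hf
  have hZpoly : ∀ j, IsPolyOn A (p ^ v j - 1) fun a =>
      ((Z j a).choose (p ^ v j - 1) : ZMod p) := fun j => by
    refine (IsPolyOn.choose_sum (w := 1) Finset.univ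
      (fun i t => ((t : ZMod (p ^ v j)) * x i j).val) _ (fun i e => ?_) _).mono (one_mul _).le
    rw [one_mul]
    refine IsPolyOn.choose_of_card_le i (hinj i)
      (fun t => ((t : ZMod (p ^ v j)) * x i j).val) ((x i j).val : ZMod p) (fun t => ?_) e
    have hdvd : ((p ^ v j : ℕ) : ℤ) ∣
        t * ((x i j).val : ℤ) - (((t : ZMod (p ^ v j)) * x i j).val : ℤ) := by
      rw [← ZMod.intCast_eq_intCast_iff_dvd_sub]
      simp
    have hpdvd : (p : ℤ) ∣ ((p ^ v j : ℕ) : ℤ) := by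
      exact_mod_cast dvd_pow_self p (hv j).ne'
    have := (ZMod.intCast_eq_intCast_iff_dvd_sub _ _ p).2 (hpdvd.trans hdvd)
    simpa using this
  have hWpoly : IsPolyOn A ((M - 1) * (p ^ k - 1)) fun a =>
      ((W a).choose (p ^ k - 1) : ZMod p) := by
    refine IsPolyOn.choose_sum Finset.univ (fun _ t => if t ≠ 0 then 1 else 0) _
      (fun i e => ?_) _
    rcases Nat.eq_zero_or_pos e with rfl | he
    · simpa using IsPolyOn.const (A := A) (d := 0) (1 : ZMod p)
    · refine IsPolyOn.of_card_le i (hinj i) ?_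
        fun t => (((if t ≠ 0 then 1 else 0 : ℕ).choose e : ℕ) : ZMod p)
      have := Nat.le_mul_of_pos_right (M - 1) he
      have := hMle i
      omega
  have hfpoly : IsPolyOn A (∑ j, (p ^ v j - 1) + (M - 1) * (p ^ k - 1)) f :=
    (IsPolyOn.prod Finset.univ fun j _ => hZpoly j).mul hWpoly
  have hZne : ∀ a j, ((Z j a).choose (p ^ v j - 1) : ZMod p) ≠ 0 ↔
      (∑ i, a i • x i) j = g j := fun a j => by
    rw [Ne, ZMod.natCast_eq_zero_iff, not_dvd_choose_prime_pow_sub_one_iff hp,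
      ← ZMod.natCast_eq_zero_iff]
    simp only [hZ, Nat.cast_add, Nat.cast_sum, ZMod.natCast_zmod_val, Nat.cast_one,
      Finset.sum_apply, zsmul_eq_mul]
    rw [← sub_eq_zero (b := g j)]
    have : ∀ i, ((a i : ∀ j, ZMod (p ^ v j)) * x i) j = (a i : ZMod (p ^ v j)) * x i j :=
      fun i => by simp
    simp only [this]
    ring_nf
  have hWne : ∀ a, ((W a).choose (p ^ k - 1) : ZMod p) ≠ 0 ↔
      p ^ k ∣ (Finset.univ.filter fun i => a i ≠ 0).card := fun a => by
    rw [Ne, ZMod.natCast_eq_zero_iff, not_dvd_choose_prime_pow_sub_one_iff hp]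
    simp only [hW]
    rw [add_assoc, Nat.sub_add_cancel (hpos k), Nat.dvd_add_self_right, Finset.card_filter]
  have hset : {a : Fin n → ℤ | (∀ i, a i ∈ A i) ∧ (∑ i, a i • x i = g) ∧
      p ^ k ∣ (Finset.univ.filter fun i => a i ≠ 0).card} =
      ((Fintype.piFinset A).filter fun a => f a ≠ 0 : Finset (Fin n → ℤ)) := by
    ext a
    rw [Finset.mem_coe, Finset.mem_filter, Fintype.mem_piFinset, Set.mem_ofPred_eq, hf,
      mul_ne_zero_iff, Finset.prod_ne_zero_iff, hWne, funext_iff]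
    simp only [hZne, Finset.mem_univ, true_imp_iff]
  rw [hset, Set.ncard_coe_finset, or_iff_not_imp_left]
  intro hne
  obtain ⟨a, ha⟩ := Finset.card_pos.1 (Nat.pos_of_ne_zero hne)
  have hmain := mBB_le_card_filter_ne_zero A hinj hfpoly ⟨a, Finset.mem_filter.1 ha⟩
  convert hmain using 2
  push_cast [Nat.cast_sub hM1, Nat.cast_sub (hpos _)]
  ring
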